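/- Let N ≥ 1 and ρ₀, …, ρ_{N−1} > 0. Suppose u₀, …, u_{N−1} with u_j : [0, ∞) × [j, j+1] → ℂ twice continuously differentiable satisfy, for all t > 0: the Schrödinger equations ∂ₜu_j(t, x) + i·ρ_j·∂ₓ²u_j(t, x) = 0 on [j, j+1]; the boundary conditions ρ₀·∂ₓu₀(t, 0) = i·u₀(t, 0) and u_{N−1}(t, N) = 0; the continuity conditions u_{j−1}(t, j) = u_j(t, j) for j = 1, …, N−1; and the flux conditions ρ_{j−1}·∂ₓu_{j−1}(t, j) = ρ_j·∂ₓu_j(t, j) for j = 1, …, N−1. Define the energy E(t) = (1/2)·Σ_{j=0}^{N−1} ∫_j^{j+1} |u_j(t, x)|² dx. Then for every t > 0, E is differentiable at t and E'(t) = −|u₀(t, 0)|². In particular E is nonincreasing. -/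

import Mathlib

open Complex Set

/-- The energy `E(t) = (1/2) Σ_j ∫_j^{j+1} |u_j(t,x)|² dx` of the Schrödinger system on a
chain of `N` serially connected strings. -/
noncomputable def chainSchrodingerEnergy (N : ℕ) (u : ℕ → ℝ → ℝ → ℂ) (t : ℝ) : ℝ :=
  (1 / 2) * ∑ j ∈ Finset.range N, ∫ x in (j : ℝ)..(j + 1), ‖u j t x‖ ^ 2

theorem string_deriv (a b r : ℝ) (hab : a < b) (v : ℝ → ℝ → ℂ)
    (hv : ContDiffOn ℝ 2 (fun p : ℝ × ℝ => v p.1 p.2) (Ici (0 : ℝ) ×ˢ Icc a b))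
    (t : ℝ) (ht : 0 < t)
    (hs : ∀ x ∈ Icc a b, deriv (fun s => v s x) t + Complex.I * (r : ℂ) *
      derivWithin (fun y => derivWithin (fun y' => v t y') (Icc a b) y) (Icc a b) x = 0) :
    HasDerivAt (fun s => ∫ x in a..b, ‖v s x‖ ^ 2)
      (2 * (inner ℝ (Complex.I * v t b) ((r : ℂ) * derivWithin (fun y => v t y) (Icc a b) b) -
        inner ℝ (Complex.I * v t a) ((r : ℂ) * derivWithin (fun y => v t y) (Icc a b) a))) t := by
  set V : ℝ × ℝ → ℂ := fun p => v p.1 p.2 with hV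
  set S : Set (ℝ × ℝ) := Ici (0 : ℝ) ×ˢ Icc a b with hS
  have huS : UniqueDiffOn ℝ S := (uniqueDiffOn_Ici 0).prod (uniqueDiffOn_Icc hab)
  have huI : UniqueDiffOn ℝ (Icc a b) := uniqueDiffOn_Icc hab
  have hD : ContDiffOn ℝ 1 (fderivWithin ℝ V S) S := hv.fderivWithin huS (by norm_num)
  have hVd : ∀ p ∈ S, HasFDerivWithinAt V (fderivWithin ℝ V S p) S p := fun p hp =>
    ((hv.differentiableOn (by norm_num)) p hp).hasFDerivWithinAt
  set vt : ℝ → ℝ → ℂ := fun s x => fderivWithin ℝ V S (s, x) (1, 0) with hvt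
  set w : ℝ → ℂ := fun x => derivWithin (fun y => v t y) (Icc a b) x with hw
  have h1 : ∀ s > 0, ∀ x ∈ Icc a b, HasDerivAt (fun s => v s x) (vt s x) s := by
    intro s hs0 x hx
    have hc : HasDerivWithinAt (fun s : ℝ => (s, x)) ((1 : ℝ), (0 : ℝ)) (Ici 0) s :=
      ((hasDerivAt_id s).prodMk (hasDerivAt_const s x)).hasDerivWithinAt
    have := (hVd (s, x) ⟨hs0.le, hx⟩).comp_hasDerivWithinAt s hc (t := S) (show MapsTo (fun s : ℝ => (s, x)) (Ici 0) S from fun y hy => ⟨hy, hx⟩)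
    exact this.hasDerivAt (Ici_mem_nhds hs0)
  have h2 : ∀ x ∈ Icc a b, HasDerivWithinAt (fun y => v t y)
      (fderivWithin ℝ V S (t, x) (0, 1)) (Icc a b) x := by
    intro x hx
    have hc : HasDerivWithinAt (fun y : ℝ => (t, y)) ((0 : ℝ), (1 : ℝ)) (Icc a b) x :=
      ((hasDerivAt_const x t).prodMk (hasDerivAt_id x)).hasDerivWithinAt
    exact (hVd (t, x) ⟨ht.le, hx⟩).comp_hasDerivWithinAt x hc (fun y hy => ⟨ht.le, hy⟩)
  have hwe : ∀ x ∈ Icc a b, w x = fderivWithin ℝ V S (t, x) (0, 1) := fun x hx =>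
    (h2 x hx).derivWithin (huI x hx)
  have hwC : ContDiffOn ℝ 1 w (Icc a b) := by
    have hc : ContDiffOn ℝ 1 (fun y : ℝ => (t, y)) (Icc a b) := by fun_prop
    have := hD.comp hc (fun y hy => ⟨ht.le, hy⟩)
    have h3 : ContDiffOn ℝ 1 (fun y => fderivWithin ℝ V S (t, y) (0, 1)) (Icc a b) :=
      this.clm_apply contDiffOn_const
    exact h3.congr hwe
  have hvtc : ContinuousOn (fun p : ℝ × ℝ => vt p.1 p.2) S :=
    hD.continuousOn.clm_apply continuousOn_const
  have hVc : ContinuousOn V S := hv.continuousOn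
  -- slices
  have slice : ∀ s > 0, ContinuousOn (fun x => v s x) (Icc a b) := fun s hs0 =>
    hVc.comp (f := fun x : ℝ => (s, x)) (by fun_prop) (fun y hy => ⟨le_of_lt hs0, hy⟩)
  have slicet : ∀ s > 0, ContinuousOn (fun x => vt s x) (Icc a b) := fun s hs0 =>
    hvtc.comp (f := fun x : ℝ => (s, x)) (by fun_prop) (fun y hy => ⟨le_of_lt hs0, hy⟩)
  -- bound
  have hgc : ContinuousOn (fun p : ℝ × ℝ => 2 * inner ℝ (V p) (vt p.1 p.2)) S :=
    continuousOn_const.mul (hVc.inner hvtc)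
  obtain ⟨C, hC⟩ := (isCompact_Icc.prod isCompact_Icc :
      IsCompact (Icc (t/2) (2*t) ×ˢ Icc a b)).exists_bound_of_continuousOn
    (hgc.mono (fun p hp => ⟨by have := hp.1.1; simp only [mem_Ici]; linarith, hp.2⟩))
  have hU : Icc (t/2) (2*t) ∈ nhds t := Icc_mem_nhds (by linarith) (by linarith)
  have hgi : ContinuousOn (fun x => 2 * inner ℝ (v t x) (vt t x)) (Icc a b) :=
    continuousOn_const.mul ((slice t ht).inner (slicet t ht))
  have key := (intervalIntegral.hasDerivAt_integral_of_dominated_loc_of_deriv_le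
    (μ := MeasureTheory.volume) (a := a) (b := b)
    (F := fun s x => ‖v s x‖ ^ 2) (F' := fun s x => 2 * inner ℝ (v s x) (vt s x))
    (x₀ := t) (s := Icc (t/2) (2*t)) (bound := fun _ => C) hU
    (by
      filter_upwards [Ioi_mem_nhds ht] with s hs0
      have : ContinuousOn (fun x => ‖v s x‖ ^ 2) (Icc a b) := (slice s hs0).norm.pow 2
      rw [uIoc_of_le hab.le]
      exact (this.mono Ioc_subset_Icc_self).aestronglyMeasurable measurableSet_Ioc)
    (by
      have : ContinuousOn (fun x => ‖v t x‖ ^ 2) (Icc a b) := (slice t ht).norm.pow 2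
      exact this.intervalIntegrable_of_Icc hab.le)
    (by
      rw [uIoc_of_le hab.le]
      exact (hgi.mono Ioc_subset_Icc_self).aestronglyMeasurable measurableSet_Ioc)
    (by
      refine Filter.Eventually.of_forall fun x hx s hs' => ?_
      rw [uIoc_of_le hab.le] at hx
      exact hC (s, x) ⟨hs', Ioc_subset_Icc_self hx⟩)
    intervalIntegrable_const
    (by
      refine Filter.Eventually.of_forall fun x hx s hs' => ?_
      rw [uIoc_of_le hab.le] at hx
      exact (h1 s (by have := hs'.1; linarith) x (Ioc_subset_Icc_self hx)).norm_sq)).2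
  have ftc : ∫ x in a..b, 2 * inner ℝ (v t x) (vt t x) =
      2 * inner ℝ (Complex.I * v t b) ((r : ℂ) * w b) -
        2 * inner ℝ (Complex.I * v t a) ((r : ℂ) * w a) := by
    refine intervalIntegral.integral_eq_sub_of_hasDerivAt_of_le (f := fun x =>
      2 * inner ℝ (Complex.I * v t x) ((r : ℂ) * w x)) hab.le ?_ ?_
      (hgi.intervalIntegrable_of_Icc hab.le)
    · exact continuousOn_const.mul ((continuousOn_const.mul (slice t ht)).inner
        (continuousOn_const.mul hwC.continuousOn))
    · intro x hx
      have hx' := Ioo_subset_Icc_self hx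
      have hn : Icc a b ∈ nhds x := Icc_mem_nhds hx.1 hx.2
      have e1 : HasDerivAt (fun y => v t y) (w x) x := by
        rw [hwe x hx']; exact (h2 x hx').hasDerivAt hn
      have e2 : HasDerivAt w (derivWithin w (Icc a b) x) x :=
        ((hwC.differentiableOn (by norm_num)) x hx').hasDerivWithinAt.hasDerivAt hn
      have e3 := (((e1.const_mul Complex.I).inner ℝ (e2.const_mul (r : ℂ))).const_mul 2)
      refine e3.congr_deriv ?_
      have hh := hs x hx'
      rw [(h1 t ht x hx').deriv] at hh
      have h4 : vt t x = -(Complex.I * r * derivWithin w (Icc a b) x) :=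
        eq_neg_of_add_eq_zero_left hh
      rw [h4]
      simp only [Complex.inner, Complex.mul_re, Complex.mul_im, Complex.neg_re, Complex.neg_im,
        Complex.conj_re, Complex.conj_im, Complex.I_re, Complex.I_im, Complex.ofReal_re,
        Complex.ofReal_im]
      ring
  rw [ftc] at key
  rw [mul_sub]
  exact key

/-- dissipation law for the damped Schrödinger system on a chain of `N`
strings: for classical (C²) solutions of `∂ₜu_j + i ρ_j ∂ₓ²u_j = 0` with the feedback
condition `ρ₀ ∂ₓu₀(t,0) = i u₀(t,0)`, the clamping `u_{N−1}(t,N) = 0`, and the continuity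
and flux conditions at the interior nodes, the energy satisfies `E'(t) = −|u₀(t,0)|²` for
every `t > 0`; in particular `E` is nonincreasing on `(0, ∞)`. -/
theorem stmt14 (N : ℕ) (hN : 1 ≤ N) (ρ : ℕ → ℝ) (hρ : ∀ j < N, 0 < ρ j)
    (u : ℕ → ℝ → ℝ → ℂ)
    (hreg : ∀ j < N, ContDiffOn ℝ 2 (fun p : ℝ × ℝ => u j p.1 p.2)
      (Ici (0 : ℝ) ×ˢ Icc (j : ℝ) (j + 1)))
    (hschrod : ∀ j < N, ∀ t > (0 : ℝ), ∀ x ∈ Icc (j : ℝ) (j + 1),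
      deriv (fun s => u j s x) t +
        Complex.I * (ρ j : ℂ) *
          derivWithin (fun y => derivWithin (fun y' => u j t y') (Icc (j : ℝ) (j + 1)) y)
            (Icc (j : ℝ) (j + 1)) x = 0)
    (hbc0 : ∀ t > (0 : ℝ),
      (ρ 0 : ℂ) * derivWithin (fun y => u 0 t y) (Icc (0 : ℝ) 1) 0 = Complex.I * u 0 t 0)
    (hbcN : ∀ t > (0 : ℝ), u (N - 1) t N = 0)
    (hcont_node : ∀ t > (0 : ℝ), ∀ j, 1 ≤ j → j ≤ N - 1 → u (j - 1) t j = u j t j)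
    (hflux : ∀ t > (0 : ℝ), ∀ j, 1 ≤ j → j ≤ N - 1 →
      (ρ (j - 1) : ℂ) * derivWithin (fun y => u (j - 1) t y)
          (Icc ((j - 1 : ℕ) : ℝ) ((j - 1 : ℕ) + 1)) j =
        (ρ j : ℂ) * derivWithin (fun y => u j t y) (Icc (j : ℝ) (j + 1)) j) :
    (∀ t > (0 : ℝ), HasDerivAt (chainSchrodingerEnergy N u) (-‖u 0 t 0‖ ^ 2) t) ∧
    (∀ t₁ t₂ : ℝ, 0 < t₁ → t₁ ≤ t₂ →
      chainSchrodingerEnergy N u t₂ ≤ chainSchrodingerEnergy N u t₁) := by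
  have main : ∀ t > (0 : ℝ), HasDerivAt (chainSchrodingerEnergy N u) (-‖u 0 t 0‖ ^ 2) t := by
    intro t ht
    set F : ℕ → ℝ → ℝ := fun j x => inner ℝ (Complex.I * u j t x)
      ((ρ j : ℂ) * derivWithin (fun y => u j t y) (Icc (j : ℝ) (j + 1)) x) with hF
    have h := (HasDerivAt.fun_sum (u := Finset.range N) (fun j hj =>
      string_deriv (j : ℝ) (j + 1) (ρ j) (by linarith) (u j) (hreg j (Finset.mem_range.1 hj)) t ht
        (hschrod j (Finset.mem_range.1 hj) t ht))).const_mul (1 / 2 : ℝ)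
    refine HasDerivAt.congr_deriv (f := chainSchrodingerEnergy N u) h ?_
    set G : ℕ → ℝ := fun k => if k < N then F k k else 0 with hG
    have hFG : ∀ j ∈ Finset.range N, 2 * (F j (j + 1) - F j j) = 2 * (G (j + 1) - G j) := by
      intro j hj
      have hj := Finset.mem_range.1 hj
      have e0 : G j = F j j := if_pos hj
      have e1 : G (j + 1) = F j (j + 1) := by
        by_cases hlt : j + 1 < N
        · have c := hcont_node t ht (j + 1) (by omega) (by omega)
          have f := hflux t ht (j + 1) (by omega) (by omega)
          simp only [Nat.add_sub_cancel] at c f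
          simp only [hG, if_pos hlt, hF]
          rw [← f, ← c]
          push_cast
          rfl
        · have hjN : j = N - 1 := by omega
          have z := hbcN t ht
          have hN' : (N : ℝ) = (j : ℝ) + 1 := by
            have : N = j + 1 := by omega
            rw [this]; push_cast; rfl
          rw [hN', ← hjN] at z
          simp only [hG, if_neg hlt, hF, z, mul_zero, inner_zero_left]
      rw [e0, e1]
    have hsum : ∑ j ∈ Finset.range N, 2 * (F j (j + 1) - F j j) = 2 * (G N - G 0) := by
      rw [Finset.sum_congr rfl hFG, ← Finset.mul_sum, Finset.sum_range_sub]
    have hGN : G N = 0 := if_neg (lt_irrefl N)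
    have hG0 : G 0 = ‖u 0 t 0‖ ^ 2 := by
      have b := hbc0 t ht
      have : G 0 = F 0 (0 : ℕ) := if_pos (by omega)
      rw [this]
      simp only [hF, Nat.cast_zero, zero_add]
      rw [b, real_inner_self_eq_norm_sq]
      simp
    change 1 / 2 * ∑ j ∈ Finset.range N, 2 * (F j (j + 1) - F j j) = _
    rw [hsum, hGN, hG0]
    ring
  refine ⟨main, fun t₁ t₂ h1 h12 => ?_⟩
  have hanti : AntitoneOn (chainSchrodingerEnergy N u) (Ioi 0) := by
    refine antitoneOn_of_deriv_nonpos (convex_Ioi 0)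
      (fun t ht => (main t ht).continuousAt.continuousWithinAt)
      (fun t ht => ?_) (fun t ht => ?_)
    · rw [interior_Ioi] at ht
      exact (main t ht).differentiableAt.differentiableWithinAt
    · rw [interior_Ioi] at ht
      rw [(main t ht).deriv]
      have := sq_nonneg ‖u 0 t 0‖
      linarith
  exact hanti h1 (lt_of_lt_of_le h1 h12) h12
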